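/- Let K be a number field, K̄ an algebraic closure of K, and O_K̄ the integral closure of O_K in K̄. A Witt vector ξ ∈ W_{O_K}(O_K̄) is integral over O_K (with respect to the structure map sending c ∈ O_K to the constant vector with all coefficients c) if and only if ξ is automatic. -/

import Mathlib

open NumberField

noncomputable section

/-- The multiplicative monoid `I_K` of nonzero ideals of the ring of integers of `K`. -/
def IdealMonoid (K : Type) [Field K] [NumberField K] : Submonoid (Ideal (𝓞 K)) where
  carrier := {I | I ≠ ⊥}
  mul_mem' := by
    intro a b ha hb h
    rcases Ideal.mul_eq_bot.mp h with h' | h'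
    · exact ha h'
    · exact hb h'
  one_mem' := by
    simp only [Set.mem_setOf_eq, Ideal.one_eq_top]
    exact top_ne_bot

/-- `I_K`, the monoid of nonzero ideals, as a type. -/
abbrev IK (K : Type) [Field K] [NumberField K] := ↥(IdealMonoid K)

/-- `P_K`, the set of nonzero prime ideals of `𝓞 K`, as a type. -/
def PrimeIdeal (K : Type) [Field K] [NumberField K] :=
  {p : Ideal (𝓞 K) // p.IsPrime ∧ p ≠ ⊥}

/-- A nonzero prime ideal, regarded as an element of `I_K`. -/
def PrimeIdeal.toIK {K : Type} [Field K] [NumberField K] (p : PrimeIdeal K) : IK K :=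
  ⟨p.1, p.2.2⟩

/-- `#k_p`: the cardinality of the residue ring `R ⧸ p`. -/
def residueCard {R : Type} [CommRing R] (p : Ideal R) : ℕ :=
  Nat.card (R ⧸ p)

/-- The shift operator `ψ_a` on `A^{I_K}`: `(ψ_a ξ)_b = ξ_{a·b}`. -/
def shift {K : Type} [Field K] [NumberField K] {A : Type} (a : IK K)
    (ξ : IK K → A) : IK K → A :=
  fun b => ξ (a * b)

/-- For an ideal `p` of `𝓞 K` and a subset `S ⊆ A^{I_K}`, the set `p·S` of all finite
sums of products of elements of `p` with elements of (the module generated by) `S`. -/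
def idealMulSet {K : Type} [Field K] [NumberField K] {A : Type} [CommRing A]
    [Algebra (𝓞 K) A] (p : Ideal (𝓞 K)) (S : Set (IK K → A)) : Set (IK K → A) :=
  ↑(p • Submodule.span (𝓞 K) S)

/-- The descending chain `U_n(A)` of subsets of `A^{I_K}`. -/
def UnSet (K : Type) [Field K] [NumberField K] (A : Type) [CommRing A]
    [Algebra (𝓞 K) A] : ℕ → Set (IK K → A)
  | 0 => Set.univ
  | n + 1 => {ξ | ξ ∈ UnSet K A n ∧ ∀ p : PrimeIdeal K,
      shift p.toIK ξ - ξ ^ residueCard p.1 ∈ idealMulSet p.1 (UnSet K A n)}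

/-- The ring of Witt vectors `W_{O_K}(A) = ⋂ₙ U_n(A)`, as a subset of `A^{I_K}`. -/
def WittSet (K : Type) [Field K] [NumberField K] (A : Type) [CommRing A]
    [Algebra (𝓞 K) A] : Set (IK K → A) :=
  ⋂ n, UnSet K A n

/-- A deterministic finite automaton with output, over input alphabet `Δ` and
output alphabet `O`. -/
structure DFAO (Δ O : Type) : Type 1 where
  State : Type
  [finState : Finite State]
  trans : State → Δ → State
  start : State
  out : State → O

/-- The output of a DFAO on an input word, processing letters from left to right. -/
def DFAO.output {Δ O : Type} (M : DFAO Δ O) (l : List Δ) : O :=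
  M.out (l.foldl M.trans M.start)

/-- `ξ ∈ A^{I_K}` is automatic if some DFAO with input alphabet `P_K` and output
alphabet `A` produces `ξ_a` from every word of primes whose product is `a`. -/
def IsAutomatic {K : Type} [Field K] [NumberField K] {A : Type}
    (ξ : IK K → A) : Prop :=
  ∃ M : DFAO (PrimeIdeal K) A, ∀ (l : List (PrimeIdeal K)) (a : IK K),
    (a : Ideal (𝓞 K)) = (l.map Subtype.val).prod → ξ a = M.output l

/-- `v_p(a)`: the largest `e` such that `p^e` divides `a`. -/
def vIdeal {R : Type} [CommRing R] (p a : Ideal R) : ℕ :=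
  sSup {e : ℕ | p ^ e ∣ a}

section Helpers

variable {K : Type} [Field K] [NumberField K]

theorem residue_finite (p : PrimeIdeal K) : Finite (𝓞 K ⧸ p.1) :=
  p.1.finiteQuotientOfFreeOfNeBot p.2.2

theorem residueCard_eq (p : PrimeIdeal K) :
    ∃ l f : ℕ, l.Prime ∧ 0 < f ∧ residueCard p.1 = l ^ f ∧ (l : 𝓞 K) ∈ p.1 := by
  have := residue_finite p
  have hp := p.2.1
  have : p.1.IsMaximal := hp.isMaximal p.2.2
  let _ : Field (𝓞 K ⧸ p.1) := Ideal.Quotient.field p.1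
  let _ : Fintype (𝓞 K ⧸ p.1) := Fintype.ofFinite _
  obtain ⟨l, hl⟩ := CharP.exists (𝓞 K ⧸ p.1)
  obtain ⟨n, hlp, hn⟩ := FiniteField.card (𝓞 K ⧸ p.1) l
  refine ⟨l, n, hlp, n.2, ?_, ?_⟩
  · rw [residueCard, Nat.card_eq_fintype_card, hn]
  · rw [← Ideal.Quotient.eq_zero_iff_mem, map_natCast]
    exact CharP.cast_eq_zero _ l

theorem residueCard_mem (p : PrimeIdeal K) : ((residueCard p.1 : ℕ) : 𝓞 K) ∈ p.1 := by
  obtain ⟨l, f, _, hf, h, hm⟩ := residueCard_eq p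
  rw [h, Nat.cast_pow]
  exact Ideal.pow_mem_of_mem _ hm _ hf

theorem sub_pow_residueCard_mem (p : PrimeIdeal K) (c : 𝓞 K) :
    c - c ^ residueCard p.1 ∈ p.1 := by
  have := residue_finite p
  have hp := p.2.1
  have : p.1.IsMaximal := hp.isMaximal p.2.2
  let _ : Field (𝓞 K ⧸ p.1) := Ideal.Quotient.field p.1
  let _ : Fintype (𝓞 K ⧸ p.1) := Fintype.ofFinite _
  rw [← Ideal.Quotient.eq_zero_iff_mem, map_sub, map_pow, residueCard, Nat.card_eq_fintype_card,
    FiniteField.pow_card, sub_self]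

variable {A : Type} [CommRing A] [Algebra (𝓞 K) A]

theorem mul_mem_smul {R : Type} [CommRing R] [Algebra (𝓞 K) R] (p : Ideal (𝓞 K))
    (S : Subalgebra (𝓞 K) R) {x y : R} (hx : x ∈ S)
    (hy : y ∈ p • S.toSubmodule) : x * y ∈ p • S.toSubmodule := by
  induction hy using Submodule.smul_induction_on' with
  | smul r hr n hn =>
    rw [mul_smul_comm]
    exact Submodule.smul_mem_smul hr (S.mul_mem hx hn)
  | add a _ b _ ha hb =>
    rw [mul_add]
    exact add_mem ha hb

theorem add_pow_mem_smul {R : Type} [CommRing R] [Algebra (𝓞 K) R] (p : PrimeIdeal K)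
    (S : Subalgebra (𝓞 K) R) {x y : R} (hx : x ∈ S) (hy : y ∈ S) :
    x ^ residueCard p.1 + y ^ residueCard p.1 - (x + y) ^ residueCard p.1
      ∈ p.1 • S.toSubmodule := by
  obtain ⟨l, f, hl, hf, h, hm⟩ := residueCard_eq p
  rw [h]
  obtain ⟨r, hr⟩ := exists_add_pow_prime_pow_eq hl (⟨x, hx⟩ : S) ⟨y, hy⟩ f
  have hr' := congrArg Subtype.val hr
  have e : x ^ l ^ f + y ^ l ^ f - (x + y) ^ l ^ f = (l : 𝓞 K) • (-(x * y * (r : R))) := by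
    have h2 : (x + y) ^ l ^ f = x ^ l ^ f + y ^ l ^ f + (l : R) * x * y * r := by
      simpa using hr'
    rw [h2, Algebra.smul_def, map_natCast]
    ring
  rw [e]
  exact Submodule.smul_mem_smul hm (S.neg_mem (S.mul_mem (S.mul_mem hx hy) r.2))

theorem shift_add' (a : IK K) (x y : IK K → A) : shift a (x + y) = shift a x + shift a y := rfl
theorem shift_mul' (a : IK K) (x y : IK K → A) : shift a (x * y) = shift a x * shift a y := rfl
theorem shift_algebraMap (a : IK K) (c : 𝓞 K) :
    shift a (algebraMap (𝓞 K) (IK K → A) c) = algebraMap (𝓞 K) (IK K → A) c := rfl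

theorem smul_le_self' (p : Ideal (𝓞 K)) (S : Subalgebra (𝓞 K) (IK K → A)) :
    p • S.toSubmodule ≤ S.toSubmodule := Submodule.smul_le_right

theorem mem_UnSet_succ {n : ℕ} (S : Subalgebra (𝓞 K) (IK K → A))
    (hS : (S : Set (IK K → A)) = UnSet K A n) (x : IK K → A) :
    x ∈ UnSet K A (n + 1) ↔ x ∈ S ∧ ∀ p : PrimeIdeal K,
        shift p.toIK x - x ^ residueCard p.1 ∈ p.1 • S.toSubmodule := by
  have : Submodule.span (𝓞 K) (UnSet K A n) = S.toSubmodule := by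
    rw [← hS]; exact Submodule.span_eq S.toSubmodule
  change (x ∈ UnSet K A n ∧ ∀ p : PrimeIdeal K, _ ∈ idealMulSet p.1 (UnSet K A n)) ↔ _
  simp only [idealMulSet, this]
  rw [← hS]
  rfl

theorem exists_subalgebra (n : ℕ) :
    ∃ S : Subalgebra (𝓞 K) (IK K → A), (S : Set (IK K → A)) = UnSet K A n := by
  induction n with
  | zero => exact ⟨⊤, rfl⟩
  | succ n ih =>
    obtain ⟨S, hS⟩ := ih
    have hmem := mem_UnSet_succ S hS
    refine ⟨{ carrier := UnSet K A (n + 1), mul_mem' := ?_, add_mem' := ?_,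
              algebraMap_mem' := ?_ }, rfl⟩
    · intro x y hx hy
      rw [hmem] at *
      refine ⟨S.mul_mem hx.1 hy.1, fun p => ?_⟩
      have hsx : shift p.toIK x ∈ S := by
        have h1 := smul_le_self' _ _ (hx.2 p)
        have h2 := S.add_mem h1 (S.pow_mem hx.1 (residueCard p.1))
        simpa using h2
      have e : shift p.toIK (x * y) - (x * y) ^ residueCard p.1 =
          shift p.toIK x * (shift p.toIK y - y ^ residueCard p.1) +
          y ^ residueCard p.1 * (shift p.toIK x - x ^ residueCard p.1) := by
        rw [shift_mul', mul_pow]; ring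
      rw [e]
      exact add_mem (mul_mem_smul _ _ hsx (hy.2 p))
        (mul_mem_smul _ _ (S.pow_mem hy.1 _) (hx.2 p))
    · intro x y hx hy
      rw [hmem] at *
      refine ⟨S.add_mem hx.1 hy.1, fun p => ?_⟩
      have e : shift p.toIK (x + y) - (x + y) ^ residueCard p.1 =
          (shift p.toIK x - x ^ residueCard p.1) + (shift p.toIK y - y ^ residueCard p.1) +
          (x ^ residueCard p.1 + y ^ residueCard p.1 - (x + y) ^ residueCard p.1) := by
        rw [shift_add']; ring
      rw [e]
      exact add_mem (add_mem (hx.2 p) (hy.2 p)) (add_pow_mem_smul p S hx.1 hy.1)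
    · intro c
      rw [hmem]
      refine ⟨S.algebraMap_mem c, fun p => ?_⟩
      rw [shift_algebraMap, ← map_pow, ← map_sub, Algebra.algebraMap_eq_smul_one]
      exact Submodule.smul_mem_smul (sub_pow_residueCard_mem p c) S.one_mem

theorem exists_uniformizer (p : PrimeIdeal K) : ∃ π s : 𝓞 K, π ≠ 0 ∧ π ∈ p.1 ∧ s ∉ p.1 ∧
    ∀ r ∈ p.1, ∃ t, s * r = π * t := by
  have hp := p.2.1
  obtain ⟨π, h1, h2⟩ : ∃ π ∈ p.1, π ∉ p.1 ^ 2 := by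
    have h := Ideal.pow_succ_lt_pow p.2.2 1
    obtain ⟨π, h1, h2⟩ := SetLike.exists_of_lt h
    exact ⟨π, by simpa using h1, h2⟩
  obtain ⟨c, hc⟩ := (Ideal.dvd_span_singleton).2 h1
  have hcp : ¬ c ≤ p.1 := by
    intro h
    apply h2
    rw [← Ideal.span_singleton_le_iff_mem, hc, pow_two]
    exact Ideal.mul_mono_right h
  obtain ⟨s, hs, hsp⟩ := SetLike.not_le_iff_exists.1 hcp
  refine ⟨π, s, ?_, h1, hsp, ?_⟩
  · rintro rfl; exact h2 (zero_mem _)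
  · intro r hr
    have : s * r ∈ Ideal.span {π} := by
      rw [hc, mul_comm s r]; exact Ideal.mul_mem_mul hr hs
    obtain ⟨t, ht⟩ := Ideal.mem_span_singleton.1 this
    exact ⟨t, ht⟩

theorem eval_mem_map (p : Ideal (𝓞 K)) (S : Submodule (𝓞 K) (IK K → A)) {d : IK K → A}
    (hd : d ∈ p • S) (a : IK K) : d a ∈ p.map (algebraMap (𝓞 K) A) := by
  induction hd using Submodule.smul_induction_on' with
  | smul r hr n hn =>
    rw [Pi.smul_apply, Algebra.smul_def]
    exact Ideal.mul_mem_right _ _ (Ideal.mem_map_of_mem _ hr)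
  | add a _ b _ ha hb => exact add_mem ha hb

theorem exists_smul_eq {p : Ideal (𝓞 K)} {π s : 𝓞 K} (h : ∀ r ∈ p, ∃ t, s * r = π * t)
    (S : Submodule (𝓞 K) (IK K → A)) {d : IK K → A}
    (hd : d ∈ p • S) : ∃ e ∈ S, s • d = π • e := by
  induction hd using Submodule.smul_induction_on' with
  | smul r hr n hn =>
    obtain ⟨t, ht⟩ := h r hr
    exact ⟨t • n, S.smul_mem _ hn, by rw [smul_smul, smul_smul, ht]⟩
  | add a _ b _ ha hb =>
    obtain ⟨e, he, he'⟩ := ha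
    obtain ⟨f, hf, hf'⟩ := hb
    exact ⟨e + f, add_mem he hf, by rw [smul_add, smul_add, he', hf']⟩

theorem mem_of_smul_mem (p : PrimeIdeal K) {s : 𝓞 K} (hs : s ∉ p.1) (n : ℕ) {x : A}
    (h : s • x ∈ p.1.map (algebraMap (𝓞 K) A) ^ n) : x ∈ p.1.map (algebraMap (𝓞 K) A) ^ n := by
  have hm : p.1.IsMaximal := p.2.1.isMaximal p.2.2
  have hc : IsCoprime (Ideal.span {s}) (p.1 ^ n) := by
    apply IsCoprime.pow_right
    rw [isCoprime_comm, Ideal.isCoprime_iff_sup_eq]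
    refine hm.out.2 _ (lt_of_le_of_ne le_sup_left fun h => hs ?_)
    rw [h]
    exact Ideal.mem_sup_right (Ideal.mem_span_singleton_self s)
  obtain ⟨u, hu, v, hv, huv⟩ := Ideal.isCoprime_iff_exists.1 hc
  obtain ⟨w, rfl⟩ := Ideal.mem_span_singleton.1 hu
  have e : x = w • (s • x) + v • x := by
    rw [smul_smul, ← add_smul, mul_comm w s, huv, one_smul]
  rw [e]
  refine add_mem ?_ ?_
  · rw [Algebra.smul_def]; exact Ideal.mul_mem_left _ _ h
  · rw [Algebra.smul_def, ← Ideal.map_pow]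
    exact Ideal.mul_mem_right _ _ (Ideal.mem_map_of_mem _ hv)

theorem pow_sub_pow_mem (p : PrimeIdeal K) {n : ℕ} (hn : 1 ≤ n) {x y : A}
    (h : x - y ∈ p.1.map (algebraMap (𝓞 K) A) ^ n) :
    x ^ residueCard p.1 - y ^ residueCard p.1 ∈ p.1.map (algebraMap (𝓞 K) A) ^ (n + 1) := by
  obtain ⟨k, hk⟩ := Polynomial.powAddExpansion y (x - y) (residueCard p.1)
  rw [add_sub_cancel] at hk
  have e : x ^ residueCard p.1 - y ^ residueCard p.1 =
      (x - y) * ((residueCard p.1 : ℕ) : A) * y ^ (residueCard p.1 - 1) +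
       k * (x - y) ^ 2 := by
    rw [hk]; ring
  rw [e]
  have hq : ((residueCard p.1 : ℕ) : A) ∈ p.1.map (algebraMap (𝓞 K) A) := by
    have := Ideal.mem_map_of_mem (algebraMap (𝓞 K) A) (residueCard_mem p)
    simpa using this
  refine add_mem (Ideal.mul_mem_right _ _ ?_) (Ideal.mul_mem_left _ _ ?_)
  · rw [pow_succ]; exact Ideal.mul_mem_mul h hq
  · have := Ideal.pow_mem_pow h 2
    rw [← pow_mul] at this
    exact Ideal.pow_le_pow_right (by omega) this

theorem pow_card_pow_mem (p : PrimeIdeal K) (S : Submodule (𝓞 K) (IK K → A)) {ξ : IK K → A}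
    (h : shift p.toIK ξ - ξ ^ residueCard p.1 ∈ p.1 • S) (m : ℕ) (a : IK K) :
    ξ (p.toIK ^ m * a) - ξ a ^ (residueCard p.1 ^ m) ∈ p.1.map (algebraMap (𝓞 K) A) := by
  induction m with
  | zero => simp
  | succ m ih =>
    have h1 := eval_mem_map _ _ h (p.toIK ^ m * a)
    have e : p.toIK ^ (m + 1) * a = p.toIK * (p.toIK ^ m * a) := by
      rw [pow_succ']; exact mul_assoc _ _ _
    have h2 := Ideal.mem_of_dvd _ (sub_dvd_pow_sub_pow (ξ (p.toIK ^ m * a))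
      (ξ a ^ (residueCard p.1 ^ m)) (residueCard p.1)) ih
    have h3 := add_mem h1 h2
    rw [e, pow_succ, pow_mul]
    simpa [shift] using h3

theorem periodic_mod (p : PrimeIdeal K) (B : Subalgebra (𝓞 K) A)
    (hsat : ∀ (r : 𝓞 K) (x : A), r ≠ 0 → r • x ∈ B → x ∈ B) (N F : ℕ)
    (hper : ∀ x ∈ B, ∀ m ≥ N, x ^ (residueCard p.1 ^ (m + F)) - x ^ (residueCard p.1 ^ m)
      ∈ p.1.map (algebraMap (𝓞 K) A)) (n : ℕ) :
    ∀ ξ ∈ UnSet K A (n + 1), (∀ a, ξ a ∈ B) → ∀ m ≥ N + n, ∀ a : IK K,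
      ξ (p.toIK ^ (m + F) * a) - ξ (p.toIK ^ m * a)
        ∈ p.1.map (algebraMap (𝓞 K) A) ^ (n + 1) := by
  induction n with
  | zero =>
    intro ξ hξ hB m hm a
    obtain ⟨S, hS⟩ := exists_subalgebra (K := K) (A := A) 0
    have h := ((mem_UnSet_succ S hS ξ).1 hξ).2 p
    have h1 := pow_card_pow_mem p _ h (m + F) a
    have h2 := pow_card_pow_mem p _ h m a
    have h3 := hper _ (hB a) m hm
    have h4 := sub_mem (add_mem h1 h3) h2
    rw [zero_add, pow_one]
    convert h4 using 1
    ring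
  | succ n ih =>
    intro ξ hξ hB m hm a
    obtain ⟨m, rfl⟩ : ∃ k, m = k + 1 := ⟨m - 1, by omega⟩
    obtain ⟨S, hS⟩ := exists_subalgebra (K := K) (A := A) (n + 1)
    obtain ⟨hξS, h⟩ := (mem_UnSet_succ S hS ξ).1 hξ
    have h := h p
    obtain ⟨π, s, hπ0, hπ, hs, hps⟩ := exists_uniformizer p
    obtain ⟨η, hη, e⟩ := exists_smul_eq hps _ h
    have hηU : η ∈ UnSet K A (n + 1) := by rw [← hS]; exact hη
    have hξU : ξ ∈ UnSet K A (n + 1) := by rw [← hS]; exact hξS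
    have hηB : ∀ a, η a ∈ B := by
      intro a
      apply hsat π _ hπ0
      have := congrFun e a
      rw [Pi.smul_apply] at this
      rw [← Pi.smul_apply, ← e]
      exact B.smul_mem (B.sub_mem (hB _) (B.pow_mem (hB _) _)) _
    have h1 := ih η hηU hηB m (by omega) a
    have h2 := pow_sub_pow_mem p (by omega) (ih ξ hξU hB m (by omega) a)
    have key : ∀ k, s • (ξ (p.toIK ^ (k + 1) * a) - ξ (p.toIK ^ k * a) ^ residueCard p.1) =
        π • η (p.toIK ^ k * a) := by
      intro k
      have e' : p.toIK ^ (k + 1) * a = p.toIK * (p.toIK ^ k * a) := by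
        rw [pow_succ']; exact mul_assoc _ _ _
      have := congrFun e (p.toIK ^ k * a)
      rw [e']
      exact this
    apply mem_of_smul_mem p hs
    have e2 : s • (ξ (p.toIK ^ (m + 1 + F) * a) - ξ (p.toIK ^ (m + 1) * a)) =
        algebraMap (𝓞 K) A s * (ξ (p.toIK ^ (m + F) * a) ^ residueCard p.1 -
          ξ (p.toIK ^ m * a) ^ residueCard p.1) +
        (η (p.toIK ^ (m + F) * a) - η (p.toIK ^ m * a)) * algebraMap (𝓞 K) A π := by
      have k1 := key (m + F)
      have k2 := key m
      rw [Algebra.smul_def, Algebra.smul_def] at k1 k2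
      rw [Algebra.smul_def, add_right_comm m 1 F]
      linear_combination k1 - k2
    rw [e2]
    refine add_mem (Ideal.mul_mem_left _ _ h2) ?_
    rw [pow_succ]
    exact Ideal.mul_mem_mul h1 (Ideal.mem_map_of_mem _ hπ)

theorem finite_iterate {X : Type} [Finite X] (φ : X → X) :
    ∃ N F : ℕ, 0 < F ∧ ∀ m ≥ N, ∀ x, φ^[m + F] x = φ^[m] x := by
  obtain ⟨i, j, hij, h⟩ := Finite.exists_ne_map_eq_of_infinite (fun n : ℕ => φ^[n])
  wlog hlt : i < j generalizing i j
  · exact this j i hij.symm h.symm (by omega)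
  refine ⟨i, j - i, by omega, fun m hm x => ?_⟩
  obtain ⟨k, rfl⟩ := Nat.exists_eq_add_of_le hm
  have e : i + k + (j - i) = k + j := by omega
  rw [e, add_comm i k, Function.iterate_add_apply, Function.iterate_add_apply]
  exact congrArg _ (congrFun h x).symm

/-- The ring of integers of the algebraic closure. -/
abbrev OKbar (K : Type) [Field K] [NumberField K] : Type :=
  ↥(integralClosure (𝓞 K) (AlgebraicClosure K))

/-- The integral elements lying in the intermediate field `L`. -/
def subOf (L : IntermediateField K (AlgebraicClosure K)) : Subalgebra (𝓞 K) (OKbar K) :=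
  (L.toSubalgebra.restrictScalars (𝓞 K)).comap (integralClosure (𝓞 K) (AlgebraicClosure K)).val

theorem mem_subOf (L : IntermediateField K (AlgebraicClosure K)) (x : OKbar K) :
    x ∈ subOf L ↔ (x : AlgebraicClosure K) ∈ L := Iff.rfl

theorem subOf_sat (L : IntermediateField K (AlgebraicClosure K)) (r : 𝓞 K) (x : OKbar K)
    (hr : r ≠ 0) (h : r • x ∈ subOf L) : x ∈ subOf L := by
  rw [mem_subOf] at *
  have e : ((r • x : OKbar K) : AlgebraicClosure K) =
      algebraMap K (AlgebraicClosure K) (r : K) * (x : AlgebraicClosure K) := by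
    exact (congrArg Subtype.val (Algebra.smul_def r x)).trans rfl
  have hr' : algebraMap K (AlgebraicClosure K) (r : K) ≠ 0 := by
    simpa using hr
  have : (x : AlgebraicClosure K) =
      (algebraMap K (AlgebraicClosure K) (r : K))⁻¹ * ((r • x : OKbar K) : AlgebraicClosure K) := by
    rw [e, inv_mul_cancel_left₀ hr']
  rw [this]
  exact L.mul_mem (L.inv_mem (L.algebraMap_mem _)) h

theorem subOf_periodic (p : PrimeIdeal K) (L : IntermediateField K (AlgebraicClosure K))
    [FiniteDimensional K L] : ∃ N F : ℕ, 0 < F ∧ ∀ x ∈ subOf L, ∀ m ≥ N,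
      x ^ (residueCard p.1 ^ (m + F)) - x ^ (residueCard p.1 ^ m)
      ∈ p.1.map (algebraMap (𝓞 K) (OKbar K)) := by
  have : NumberField L := NumberField.of_module_finite K L
  let I : Ideal (𝓞 L) := p.1.map (algebraMap (𝓞 K) (𝓞 L))
  have hI : I ≠ ⊥ := by
    rw [Ne, Ideal.map_eq_bot_iff_of_injective (FaithfulSMul.algebraMap_injective _ _)]
    exact p.2.2
  have : Finite (𝓞 L ⧸ I) := I.finiteQuotientOfFreeOfNeBot hI
  obtain ⟨N, F, hF, h⟩ := finite_iterate (fun x : 𝓞 L ⧸ I => x ^ residueCard p.1)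
  refine ⟨N, F, hF, fun x hx m hm => ?_⟩
  have hint : ∀ y : 𝓞 L, IsIntegral (𝓞 K) (algebraMap L (AlgebraicClosure K) (y : L)) := by
    intro y
    have h1 : IsIntegral ℤ (algebraMap L (AlgebraicClosure K) (y : L)) :=
      y.isIntegral_coe.algebraMap
    exact h1.tower_top
  let φ : 𝓞 L →+* OKbar K :=
    ((algebraMap L (AlgebraicClosure K)).comp (algebraMap (𝓞 L) L)).codRestrict
      (integralClosure (𝓞 K) (AlgebraicClosure K)).toSubring hint
  have hφ : φ.comp (algebraMap (𝓞 K) (𝓞 L)) = algebraMap (𝓞 K) (OKbar K) := by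
    ext c
    rfl
  have hxi : IsIntegral ℤ (⟨(x : AlgebraicClosure K), hx⟩ : L) := by
    have h1 : IsIntegral ℤ (x : AlgebraicClosure K) := isIntegral_trans (A := 𝓞 K) _ x.2
    exact (isIntegral_algebraMap_iff (B := AlgebraicClosure K)
      (algebraMap L (AlgebraicClosure K)).injective).1 h1
  let y : 𝓞 L := ⟨⟨x, hx⟩, hxi⟩
  have hy : φ y = x := rfl
  have hmem : y ^ (residueCard p.1 ^ (m + F)) - y ^ (residueCard p.1 ^ m) ∈ I := by
    rw [← Ideal.Quotient.eq_zero_iff_mem, map_sub, sub_eq_zero, map_pow, map_pow]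
    have := h m hm (Ideal.Quotient.mk I y)
    simpa only [pow_iterate] using this
  have h2 := Ideal.mem_map_of_mem φ hmem
  rw [Ideal.map_map, hφ, map_sub, map_pow, map_pow, hy] at h2
  exact h2

theorem comap_map_pow (I : Ideal (𝓞 K)) (r : 𝓞 K)
    (h : algebraMap (𝓞 K) (OKbar K) r ∈ I.map (algebraMap (𝓞 K) (OKbar K))) : r ∈ I := by
  have e := Ideal.comap_map_eq_self_of_faithfullyFlat (B := OKbar K) I
  rw [← e]
  exact h

theorem exists_dvd_algebraMap {x : OKbar K} (hx : x ≠ 0) :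
    ∃ r : 𝓞 K, r ≠ 0 ∧ x ∣ algebraMap (𝓞 K) (OKbar K) r :=
  (Algebra.IsIntegral.isIntegral (R := 𝓞 K) x).isAlgebraic.exists_nonzero_dvd
    (mem_nonZeroDivisors_of_ne_zero hx)

theorem separate (X : Set (OKbar K)) (hX : X.Finite) (hne : X.Nonempty) :
    ∃ r : 𝓞 K, r ≠ 0 ∧ ∀ I : Ideal (𝓞 K), ∀ x ∈ X, ∀ y ∈ X, x ≠ y →
      x - y ∈ I.map (algebraMap (𝓞 K) (OKbar K)) → r ∈ I := by
  classical
  have h : ∀ z : OKbar K × OKbar K, ∃ r : 𝓞 K, r ≠ 0 ∧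
      (z.1 ≠ z.2 → z.1 - z.2 ∣ algebraMap (𝓞 K) (OKbar K) r) := by
    intro z
    by_cases hz : z.1 = z.2
    · exact ⟨1, one_ne_zero, fun h => (h hz).elim⟩
    · obtain ⟨r, h1, h2⟩ := exists_dvd_algebraMap (sub_ne_zero.2 hz)
      exact ⟨r, h1, fun _ => h2⟩
  choose f hf0 hf using h
  refine ⟨∏ z ∈ (hX.toFinset ×ˢ hX.toFinset), f z, Finset.prod_ne_zero_iff.2 fun z _ => hf0 z, ?_⟩
  intro I x hx y hy hxy hI
  have h1 : f (x, y) ∈ I := comap_map_pow I _ (Ideal.mem_of_dvd _ (hf (x, y) hxy) hI)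
  exact Ideal.mem_of_dvd _ (Finset.dvd_prod_of_mem f (by simp [hx, hy])) h1

theorem finite_primes {r : 𝓞 K} (hr : r ≠ 0) : {p : PrimeIdeal K | r ∈ p.1}.Finite := by
  have h := Ideal.finite_factors (R := 𝓞 K) (I := Ideal.span {r}) (by simpa using hr)
  refine Set.Finite.of_finite_image (f := fun p : PrimeIdeal K =>
    (⟨p.1, p.2.1, p.2.2⟩ : IsDedekindDomain.HeightOneSpectrum (𝓞 K))) (h.subset ?_) ?_
  · rintro _ ⟨p, hp, rfl⟩
    exact Ideal.dvd_span_singleton.2 hp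
  · intro p _ q _ h
    exact Subtype.ext (congrArg IsDedekindDomain.HeightOneSpectrum.asIdeal h)

theorem exists_not_mem_pow {r : 𝓞 K} (hr : r ≠ 0) (p : PrimeIdeal K) :
    ∃ n, r ∉ p.1 ^ (n + 1) := by
  by_contra! h
  apply hr
  have h1 := Ideal.iInf_pow_eq_bot_of_isDomain p.1 p.2.1.ne_top
  have : r ∈ (⨅ i, p.1 ^ i : Ideal (𝓞 K)) := by
    rw [Ideal.mem_iInf]
    intro i
    exact Ideal.pow_le_pow_right (Nat.le_succ i) (h i)
  rw [h1] at this
  simpa using this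

theorem shift_shift {X : Type} (a b : IK K) (ξ : IK K → X) :
    shift a (shift b ξ) = shift (a * b) ξ := by
  funext c
  change ξ (b * (a * c)) = ξ (a * b * c)
  congr 1
  rw [mul_comm a b]
  exact (mul_assoc _ _ _).symm

theorem orb_finite {X : Type} (ξ : IK K → X) (T : Set (IK K)) (hT : T.Finite)
    (h : ∀ p ∈ T, ∃ N F : ℕ, 0 < F ∧ ∀ m ≥ N, shift (p ^ (m + F)) ξ = shift (p ^ m) ξ) :
    {z | ∃ c ∈ Submonoid.closure T, z = shift c ξ}.Finite := by
  induction T, hT using Set.Finite.induction_on with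
  | empty =>
    refine (Set.finite_singleton (shift 1 ξ)).subset ?_
    rintro z ⟨c, hc, rfl⟩
    rw [Submonoid.closure_empty, Submonoid.mem_bot] at hc
    rw [hc]; rfl
  | @insert p T _ _ ih =>
    have ih := ih fun q hq => h q (Set.mem_insert_of_mem _ hq)
    obtain ⟨N, F, hF, hp⟩ := h p (Set.mem_insert _ _)
    have red : ∀ e, ∃ e' < N + F, shift (p ^ e) ξ = shift (p ^ e') ξ := by
      intro e
      induction e using Nat.strong_induction_on with
      | _ e IH =>
        by_cases he : e < N + F
        · exact ⟨e, he, rfl⟩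
        · obtain ⟨e', h1, h2⟩ := IH (e - F) (by omega)
          refine ⟨e', h1, ?_⟩
          rw [← h2, ← hp (e - F) (by omega), Nat.sub_add_cancel (by omega)]
    refine ((Set.finite_Iio (N + F)).biUnion fun e _ => ih.image (shift (p ^ e))).subset ?_
    rintro z ⟨c, hc, rfl⟩
    rw [Set.insert_eq, Submonoid.closure_union, Submonoid.mem_sup] at hc
    obtain ⟨y, hy, c', hc', rfl⟩ := hc
    obtain ⟨e, rfl⟩ := Submonoid.mem_closure_singleton.1 hy
    obtain ⟨e', h1, h2⟩ := red e
    simp only [Set.mem_iUnion]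
    refine ⟨e', h1, shift c' ξ, ⟨c', hc', rfl⟩, ?_⟩
    rw [shift_shift, mul_comm, ← shift_shift, ← h2, shift_shift, mul_comm]

theorem isAutomatic_of_finite {X : Type} (ξ : IK K → X) (Z : Set (IK K → X)) (hZ : Z.Finite)
    (hξ : ξ ∈ Z) (hs : ∀ z ∈ Z, ∀ p : PrimeIdeal K, shift p.toIK z ∈ Z) : IsAutomatic ξ := by
  have : Finite Z := hZ
  refine ⟨⟨Z, fun z p => ⟨shift p.toIK z.1, hs z.1 z.2 p⟩, ⟨ξ, hξ⟩, fun z => z.1 1⟩, ?_⟩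
  intro l a ha
  have key : ∀ (l : List (PrimeIdeal K)) (z : Z) (b : IK K),
      (l.foldl (fun (z : Z) (p : PrimeIdeal K) =>
        (⟨shift p.toIK z.1, hs z.1 z.2 p⟩ : Z)) z).1 b
      = z.1 ((l.map PrimeIdeal.toIK).prod * b) := by
    intro l
    induction l with
    | nil => intro z b; simp
    | cons p l ih =>
      intro z b
      rw [List.foldl_cons, ih, List.map_cons, List.prod_cons]
      change z.1 (p.toIK * (_ * b)) = _
      exact congrArg z.1 (mul_assoc p.toIK (l.map PrimeIdeal.toIK).prod b).symm
  have hl : (((l.map PrimeIdeal.toIK).prod : IK K) : Ideal (𝓞 K)) = (l.map Subtype.val).prod := by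
    rw [Submonoid.coe_list_prod, List.map_map]
    rfl
  have hal : a = (l.map PrimeIdeal.toIK).prod * 1 := by
    rw [mul_one]; exact Subtype.ext (ha.trans hl.symm)
  rw [hal]
  exact (key l ⟨ξ, hξ⟩ 1).symm

theorem isAutomatic_map {X Y : Type} (f : X → Y) (ξ : IK K → X) (h : IsAutomatic ξ) :
    IsAutomatic (fun a => f (ξ a)) := by
  obtain ⟨M, hM⟩ := h
  have := M.finState
  refine ⟨⟨M.State, M.trans, M.start, fun s => f (M.out s)⟩, fun l a ha => ?_⟩
  exact congrArg f (hM l a ha)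

theorem automatic_core {X : Type} [Finite X] (ξ : IK K → X) (T : Set (PrimeIdeal K))
    (hT : T.Finite)
    (h : ∀ p ∈ T, ∃ N F : ℕ, 0 < F ∧ ∀ m ≥ N,
      shift (p.toIK ^ (m + F)) ξ = shift (p.toIK ^ m) ξ)
    (hg : ∀ p ∉ T, ∃ g : X → X, ∀ a, ξ (p.toIK * a) = g (ξ a)) : IsAutomatic ξ := by
  have hO := orb_finite ξ (PrimeIdeal.toIK '' T) (hT.image _) (by
    rintro _ ⟨p, hp, rfl⟩; exact h p hp)
  set O := {z | ∃ c ∈ Submonoid.closure (PrimeIdeal.toIK '' T), z = shift c ξ} with hOdef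
  refine isAutomatic_of_finite ξ
    (Set.image2 (fun (g : X → X) (z : IK K → X) => fun b => g (z b)) Set.univ O)
    (Set.Finite.image2 _ Set.finite_univ hO) ?_ ?_
  · refine ⟨id, trivial, ξ, ⟨1, Submonoid.one_mem _, ?_⟩, rfl⟩
    funext b
    change ξ b = ξ (1 * b)
    rw [one_mul]
  · rintro _ ⟨g, -, _, ⟨c, hc, rfl⟩, rfl⟩ p
    by_cases hp : p ∈ T
    · refine ⟨g, trivial, shift (p.toIK * c) ξ, ⟨_, Submonoid.mul_mem _
        (Submonoid.subset_closure ⟨p, hp, rfl⟩) hc, rfl⟩, ?_⟩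
      rw [← shift_shift]
      rfl
    · obtain ⟨g', hg'⟩ := hg p hp
      refine ⟨g ∘ g', trivial, shift c ξ, ⟨c, hc, rfl⟩, ?_⟩
      funext b
      change g (g' (ξ (c * b))) = g (ξ (c * (p.toIK * b)))
      rw [← hg', mul_left_comm]

theorem finite_range_of_isIntegral (ξ : IK K → OKbar K) (h : IsIntegral (𝓞 K) ξ) :
    (Set.range ξ).Finite := by
  classical
  obtain ⟨f, hf, hfx⟩ := h
  have hf' : f.map (algebraMap (𝓞 K) (OKbar K)) ≠ 0 := (hf.map _).ne_zero
  refine ((f.map (algebraMap (𝓞 K) (OKbar K))).roots.toFinset.finite_toSet).subset ?_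
  rintro _ ⟨a, rfl⟩
  rw [Finset.mem_coe, Multiset.mem_toFinset, Polynomial.mem_roots hf', Polynomial.IsRoot,
    Polynomial.eval_map]
  have := congrArg (Pi.evalRingHom (fun _ : IK K => OKbar K) a) hfx
  rw [Polynomial.hom_eval₂] at this
  exact this

theorem isIntegral_of_finite (ξ : IK K → OKbar K) (h : (Set.range ξ).Finite) :
    IsIntegral (𝓞 K) ξ := by
  classical
  have hi : ∀ x : OKbar K, IsIntegral (𝓞 K) x := Algebra.IsIntegral.isIntegral
  choose f hf hfx using hi
  refine ⟨∏ x ∈ h.toFinset, f x, Polynomial.monic_prod_of_monic _ _ fun x _ => hf x, ?_⟩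
  funext a
  change Pi.evalRingHom (fun _ : IK K => OKbar K) a _ = 0
  rw [Polynomial.hom_eval₂, Polynomial.eval₂_finsetProd]
  refine Finset.prod_eq_zero (i := ξ a) (by simp) (hfx (ξ a))

theorem finite_range_of_isAutomatic {X : Type} (ξ : IK K → X) (h : IsAutomatic ξ)
    (hprod : ∀ a : IK K, ∃ l : List (PrimeIdeal K), (a : Ideal (𝓞 K)) = (l.map Subtype.val).prod) :
    (Set.range ξ).Finite := by
  obtain ⟨M, hM⟩ := h
  have := M.finState
  refine (Set.finite_range M.out).subset ?_
  rintro _ ⟨a, rfl⟩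
  obtain ⟨l, hl⟩ := hprod a
  exact ⟨_, (hM l a hl).symm⟩

theorem exists_list (a : IK K) :
    ∃ l : List (PrimeIdeal K), (a : Ideal (𝓞 K)) = (l.map Subtype.val).prod := by
  obtain ⟨a, ha⟩ := a
  change ∃ l : List (PrimeIdeal K), a = _
  induction a using UniqueFactorizationMonoid.induction_on_prime with
  | h₁ => exact (ha rfl).elim
  | h₂ x hx => exact ⟨[], (Ideal.isUnit_iff.1 hx).trans Ideal.one_eq_top.symm⟩
  | h₃ a p ha0 hp ih =>
    obtain ⟨l, hl⟩ := ih ha0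
    exact ⟨⟨p, Ideal.isPrime_of_prime hp, hp.ne_zero⟩ :: l,
      (congrArg (p * ·) hl).trans List.prod_cons.symm⟩

theorem automatic_of_integral (ξ : IK K → OKbar K) (hξ : ξ ∈ WittSet K (OKbar K))
    (h : IsIntegral (𝓞 K) ξ) : IsAutomatic ξ := by
  have hfin := finite_range_of_isIntegral ξ h
  have : Finite (Set.range ξ) := hfin
  have hU : ∀ n, ξ ∈ UnSet K (OKbar K) n := fun n => Set.mem_iInter.1 hξ n
  obtain ⟨r, hr, hsep⟩ := separate (Set.range ξ) hfin ⟨_, 1, rfl⟩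
  let ξ' : IK K → Set.range ξ := fun a => ⟨ξ a, a, rfl⟩
  suffices IsAutomatic ξ' from isAutomatic_map Subtype.val ξ' this
  have heq : ∀ (I : Ideal (𝓞 K)) (a b : IK K), r ∉ I →
      ξ a - ξ b ∈ I.map (algebraMap (𝓞 K) (OKbar K)) → ξ a = ξ b := by
    intro I a b hrI hab
    by_contra hne
    exact hrI (hsep I _ ⟨a, rfl⟩ _ ⟨b, rfl⟩ hne hab)
  refine automatic_core ξ' {p | r ∈ p.1} (finite_primes hr) ?_ ?_
  · intro p _
    let L : IntermediateField K (AlgebraicClosure K) :=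
      IntermediateField.adjoin K (Subtype.val '' Set.range ξ)
    have hfinL : Finite (Subtype.val '' Set.range ξ : Set (AlgebraicClosure K)) :=
      (hfin.image _)
    have : FiniteDimensional K L :=
      IntermediateField.finiteDimensional_adjoin fun x _ => Algebra.IsIntegral.isIntegral x
    obtain ⟨N, F, hF, hper⟩ := subOf_periodic p L
    have hB : ∀ a, ξ a ∈ subOf L := fun a =>
      IntermediateField.subset_adjoin K _ ⟨_, ⟨a, rfl⟩, rfl⟩
    obtain ⟨n, hn⟩ := exists_not_mem_pow hr p
    refine ⟨N + n, F, hF, fun m hm => ?_⟩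
    funext a
    apply Subtype.ext
    refine heq _ _ _ hn ?_
    rw [Ideal.map_pow]
    exact periodic_mod p (subOf L) (subOf_sat L) N F hper n ξ (hU _) hB m hm a
  · intro p hp
    obtain ⟨S, hS⟩ := exists_subalgebra (K := K) (A := OKbar K) 0
    have h1 := ((mem_UnSet_succ S hS ξ).1 (hU 1)).2 p
    have hdet : ∀ a b, ξ a = ξ b → ξ (p.toIK * a) = ξ (p.toIK * b) := by
      intro a b hab
      refine heq p.1 _ _ hp ?_
      have h2 := sub_mem (eval_mem_map _ _ h1 a) (eval_mem_map _ _ h1 b)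
      simpa [shift, hab] using h2
    refine ⟨fun x => ξ' (p.toIK * x.2.choose), fun a => Subtype.ext ?_⟩
    exact hdet _ _ (ξ' a).2.choose_spec.symm

end Helpers

/-- a Witt vector `ξ ∈ W_{O_K}(O_K̄)`, where `O_K̄` is the integral
closure of `O_K` in an algebraic closure `K̄` of `K`, is integral over `O_K` if and
only if it is automatic. -/
theorem arithmetic_christol_closure (K : Type) [Field K] [NumberField K]
    (ξ : IK K → ↥(integralClosure (𝓞 K) (AlgebraicClosure K)))
    (hξ : ξ ∈ WittSet K ↥(integralClosure (𝓞 K) (AlgebraicClosure K))) :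
    IsIntegral (𝓞 K) ξ ↔ IsAutomatic ξ := by
  exact ⟨automatic_of_integral ξ hξ, fun h =>
    isIntegral_of_finite ξ (finite_range_of_isAutomatic ξ h exists_list)⟩

end
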